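/- arXiv:math/9710209 — 4 statements merged into one kernel-verified Lean document; each statement's English description precedes it below -/
import Mathlib

section
/- Let U ⊆ ℂ be open and let y be holomorphic on U with y''(x) = 6 y(x)² + x, y(x) ≠ 0 and y'(x) ≠ 0 for all x ∈ U. Define v₁(x) = − y'(x)/y(x)² and w₁(x) = y(x)³/y'(x)². Then for all x ∈ U: v₁'(x) = 2/w₁(x) − 6 − x·w₁(x)²·v₁(x)⁴ and w₁'(x) = (12/v₁(x))·(w₁(x) − 1/4) + 2x·w₁(x)³·v₁(x)³. -/
/-- Under the rational change of dependent variables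
`v₁ = −y'/y²`, `w₁ = y³/y'²`, a holomorphic solution of Painlevé I `y'' = 6y² + x`
(with `y` and `y'` nonvanishing) yields a solution of system (2.5). -/
theorem painleveI_to_system25
    (U : Set ℂ) (hU : IsOpen U) (y : ℂ → ℂ) (hy : DifferentiableOn ℂ y U)
    (hode : ∀ x ∈ U, deriv (deriv y) x = 6 * y x ^ 2 + x)
    (hy0 : ∀ x ∈ U, y x ≠ 0) (hy'0 : ∀ x ∈ U, deriv y x ≠ 0) :
    ∀ x ∈ U,
      deriv (fun x => -(deriv y x) / (y x) ^ 2) x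
          = 2 / ((y x) ^ 3 / (deriv y x) ^ 2) - 6
            - x * ((y x) ^ 3 / (deriv y x) ^ 2) ^ 2 * (-(deriv y x) / (y x) ^ 2) ^ 4 ∧
      deriv (fun x => (y x) ^ 3 / (deriv y x) ^ 2) x
          = 12 / (-(deriv y x) / (y x) ^ 2) * ((y x) ^ 3 / (deriv y x) ^ 2 - 1/4)
            + 2 * x * ((y x) ^ 3 / (deriv y x) ^ 2) ^ 3 * (-(deriv y x) / (y x) ^ 2) ^ 3 := by
  intro x hx
  have hU' : U ∈ nhds x := hU.mem_nhds hx
  have h0 := hy0 x hx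
  have h1 := hy'0 x hx
  have hd : HasDerivAt y (deriv y x) x := (hy.differentiableAt hU').hasDerivAt
  have hd' : HasDerivAt (deriv y) (6 * y x ^ 2 + x) x := by
    rw [← hode x hx]
    exact ((hy.deriv hU).differentiableAt hU').hasDerivAt
  constructor
  · rw [(hd'.fun_neg.fun_div (hd.fun_pow 2) (pow_ne_zero 2 h0)).deriv]
    field_simp
    ring
  · rw [((hd.fun_pow 3).fun_div (hd'.fun_pow 2) (pow_ne_zero 2 h1)).deriv]
    field_simp
    ring
end

section
/- Let D ⊆ ℂ be open and let u be holomorphic on D with u''(t) = 6 u(t)², u(t) ≠ 0 and u'(t) ≠ 0 for all t ∈ D. Define v(t) = − u'(t)/u(t)² and w(t) = u(t)³/u'(t)². Then for all t ∈ D: v'(t) = 2/w(t) − 6 and w'(t) = (12/v(t))·(w(t) − 1/4). -/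
/-- Under the rational change of dependent variables
`v = −u'/u²`, `w = u³/u'²`, a holomorphic solution of the elliptic equation `u'' = 6u²`
(with `u` and `u'` nonvanishing) yields a solution of system (2.6). -/
theorem elliptic_to_system26
    (D : Set ℂ) (hD : IsOpen D) (u : ℂ → ℂ) (hu : DifferentiableOn ℂ u D)
    (hode : ∀ t ∈ D, deriv (deriv u) t = 6 * u t ^ 2)
    (hu0 : ∀ t ∈ D, u t ≠ 0) (hu'0 : ∀ t ∈ D, deriv u t ≠ 0) :
    ∀ t ∈ D,
      deriv (fun t => -(deriv u t) / (u t) ^ 2) t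
          = 2 / ((u t) ^ 3 / (deriv u t) ^ 2) - 6 ∧
      deriv (fun t => (u t) ^ 3 / (deriv u t) ^ 2) t
          = 12 / (-(deriv u t) / (u t) ^ 2) * ((u t) ^ 3 / (deriv u t) ^ 2 - 1/4) := by
  intro t ht
  have hu1 : HasDerivAt u (deriv u t) t :=
    (hu.differentiableAt (hD.mem_nhds ht)).hasDerivAt
  have hu2 : HasDerivAt (deriv u) (6 * u t ^ 2) t := by
    rw [← hode t ht]
    exact ((hu.deriv hD).differentiableAt (hD.mem_nhds ht)).hasDerivAt
  have h0 := hu0 t ht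
  have h1 := hu'0 t ht
  constructor
  · refine (hu2.fun_neg.fun_div (hu1.fun_pow 2) (pow_ne_zero 2 h0)).deriv.trans ?_
    field_simp
    ring
  · refine ((hu1.fun_pow 3).fun_div (hu2.fun_pow 2) (pow_ne_zero 2 h1)).deriv.trans ?_
    field_simp
    ring
end

section
/- Let Ω ⊆ ℂ³ (coordinates (t,v,w)) be open with v ≠ 0 and w ≠ 0 on Ω, and let γ be holomorphic on Ω satisfying v·(L²γ) + 6·(Lγ) − (6 + w²v⁴γ)·(Lγ)³ = 0 on Ω, where L = ∂/∂t + (2/w − 6)·∂/∂v + (12/v)(w − 1/4)·∂/∂w. Define η = v/(Lγ) and θ = v²w/η² where Lγ ≠ 0. Let (v(t), w(t)) be a holomorphic solution of v' = 2/w − 6, w' = (12/v)(w − 1/4) on an open disk B whose trajectory {(t, v(t), w(t)) : t ∈ B} lies in Ω with Lγ ≠ 0 along it, and suppose φ(t) := γ(t, v(t), w(t)) is injective on B with nonvanishing derivative. Then the functions v₁(x) := η(φ⁻¹(x), v(φ⁻¹(x)), w(φ⁻¹(x))) and w₁(x) := θ(φ⁻¹(x), v(φ⁻¹(x)), w(φ⁻¹(x)))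 satisfy, for x ∈ φ(B): v₁'(x) = 2/w₁(x) − 6 − x·w₁(x)²·v₁(x)⁴ and w₁'(x) = (12/v₁(x))·(w₁(x) − 1/4) + 2x·w₁(x)³·v₁(x)³. -/
open Metric

/-- The first-order differential operator
`L = ∂/∂t + (2/w − 6) ∂/∂v + (12/v)(w − 1/4) ∂/∂w`
acting on functions of `(t, v, w) ∈ ℂ³`. -/
noncomputable def Lop (γ : ℂ × ℂ × ℂ → ℂ) : ℂ × ℂ × ℂ → ℂ := fun p =>
  deriv (fun t => γ (t, p.2.1, p.2.2)) p.1
    + (2 / p.2.2 - 6) * deriv (fun v => γ (p.1, v, p.2.2)) p.2.1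
    + 12 / p.2.1 * (p.2.2 - 1/4) * deriv (fun w => γ (p.1, p.2.1, w)) p.2.2

/-- Directional derivatives of a holomorphic function of several variables are holomorphic. -/
theorem differentiableOn_fderiv_apply_const {E : Type*} [NormedAddCommGroup E]
    [NormedSpace ℂ E] [FiniteDimensional ℂ E] {U : Set E} {f : E → ℂ}
    (hf : DifferentiableOn ℂ f U) (hU : IsOpen U) (e : E) :
    DifferentiableOn ℂ (fun p => fderiv ℂ f p e) U := by
  intro p hp
  apply DifferentiableAt.differentiableWithinAt
  obtain ⟨δ, hδ, hball⟩ : ∃ δ > 0, ball p δ ⊆ U ∩ f ⁻¹' ball (f p) 1 := by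
    refine Metric.mem_nhds_iff.mp (Filter.inter_mem (hU.mem_nhds hp) ?_)
    exact (hf.differentiableAt (hU.mem_nhds hp)).continuousAt (ball_mem_nhds _ one_pos)
  have hfball : DifferentiableOn ℂ f (ball p δ) := hf.mono fun x hx => (hball hx).1
  set R : ℝ := δ / (4 * (‖e‖ + 1)) with hR
  have hRpos : 0 < R := by positivity
  have hRe : R * ‖e‖ ≤ δ / 4 := by
    rw [hR, div_mul_eq_mul_div, div_le_div_iff₀ (by positivity) (by norm_num)]
    nlinarith [norm_nonneg e]
  have hmem : ∀ x ∈ ball p (δ / 4), ∀ z : ℂ, ‖z‖ ≤ R → x + z • e ∈ ball p (δ / 2) := by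
    intro x hx z hz
    rw [mem_ball, dist_eq_norm] at hx ⊢
    calc ‖x + z • e - p‖ = ‖(x - p) + z • e‖ := by congr 1; abel
      _ ≤ ‖x - p‖ + ‖z‖ * ‖e‖ := (norm_add_le _ _).trans_eq (by rw [norm_smul])
      _ ≤ ‖x - p‖ + R * ‖e‖ := by gcongr
      _ < δ / 2 := by linarith
  have hsub : ball p (δ / 2) ⊆ ball p δ := ball_subset_ball (by linarith)
  have hdiff : ∀ y ∈ ball p (δ / 2), DifferentiableAt ℂ f y := fun y hy =>
    hfball.differentiableAt (isOpen_ball.mem_nhds (hsub hy))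
  have hbound : ∀ y ∈ ball p (δ / 2), ‖fderiv ℂ f y‖ ≤ 2 / (δ / 2) := by
    intro y hy
    have hy' : ball y (δ / 2) ⊆ ball p δ := ball_subset_ball' (by
      rw [mem_ball] at hy; linarith)
    refine Complex.norm_fderiv_le_div_of_mapsTo_ball (hfball.mono hy') ?_ (by positivity)
    intro z hz
    have h1 : dist (f z) (f p) < 1 := (hball (hy' hz)).2
    have h2 : dist (f y) (f p) < 1 := (hball (hsub hy)).2
    rw [mem_closedBall]
    linarith [dist_triangle_right (f z) (f y) (f p)]
  have hcirc : ∀ θ, ‖circleMap 0 R θ‖ ≤ R := fun θ => by simp [abs_of_pos hRpos]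
  set k : ℝ → ℂ := fun θ => deriv (circleMap 0 R) θ * ((circleMap 0 R θ) ^ 2)⁻¹ with hk
  have hkc : Continuous k := by
    have h0 : ∀ θ, (circleMap 0 R θ) ^ 2 ≠ 0 := fun θ =>
      pow_ne_zero _ (circleMap_ne_center hRpos.ne')
    simp only [hk, deriv_circleMap]
    exact ((continuous_circleMap 0 R).mul continuous_const).mul
      (((continuous_circleMap 0 R).pow 2).inv₀ h0)
  have hFc : ∀ x ∈ ball p (δ / 4), Continuous fun θ => k θ * f (x + circleMap 0 R θ • e) := by
    intro x hx
    refine hkc.mul (continuous_iff_continuousAt.mpr fun θ => ?_)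
    refine ContinuousAt.comp (f := fun θ => x + circleMap 0 R θ • e)
      (hdiff _ (hmem x hx _ (hcirc θ))).continuousAt ?_
    fun_prop
  have hcauchy : ∀ x ∈ ball p (δ / 4), fderiv ℂ f x e =
      (2 * Real.pi * Complex.I : ℂ)⁻¹ *
        ∫ θ in (0 : ℝ)..2 * Real.pi, k θ * f (x + circleMap 0 R θ • e) := by
    intro x hx
    have hline : ∀ z : ℂ, HasDerivAt (fun z : ℂ => x + z • e) e z := fun z => by
      simpa using ((hasDerivAt_id z).smul_const e).const_add x
    set V : Set ℂ := (fun z : ℂ => x + z • e) ⁻¹' ball p (δ / 2) with hV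
    have hVo : IsOpen V := isOpen_ball.preimage (by fun_prop)
    have hd : DifferentiableOn ℂ (fun z : ℂ => f (x + z • e)) V := fun z hz =>
      ((hdiff _ hz).comp z (hline z).differentiableAt).differentiableWithinAt
    have hc := Complex.cderiv_eq_deriv hVo hd hRpos (z := 0) fun z hz =>
      hmem x hx z (by simpa using hz)
    have hx0 : HasFDerivAt f (fderiv ℂ f x) (x + (0 : ℂ) • e) := by
      simpa using (hdiff _ (by simpa using hmem x hx 0 (by simpa using hRpos.le))).hasFDerivAt
    rw [← (hx0.comp_hasDerivAt (0 : ℂ) (hline 0)).deriv]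
    refine hc.symm.trans ?_
    simp only [Complex.cderiv, circleIntegral, smul_eq_mul, sub_zero, hk, mul_assoc]
  have hp4 : ball p (δ / 4) ∈ nhds p := ball_mem_nhds _ (by positivity)
  have hint : HasFDerivAt
      (fun x => ∫ θ in (0 : ℝ)..2 * Real.pi, k θ * f (x + circleMap 0 R θ • e))
      (∫ θ in (0 : ℝ)..2 * Real.pi, k θ • fderiv ℂ f (p + circleMap 0 R θ • e)) p := by
    refine intervalIntegral.hasFDerivAt_integral_of_dominated_of_fderiv_le
      (F' := fun x θ => k θ • fderiv ℂ f (x + circleMap 0 R θ • e))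
      (bound := fun θ => ‖k θ‖ * (2 / (δ / 2))) hp4 ?_ ?_ ?_ ?_ ?_ ?_
    · filter_upwards [hp4] with x hx using (hFc x hx).aestronglyMeasurable
    · exact (hFc p (mem_ball_self (by positivity))).intervalIntegrable _ _
    · borelize E
      have : ProperSpace E := FiniteDimensional.proper ℂ E
      have : ProperSpace (E →L[ℂ] ℂ) := FiniteDimensional.proper ℂ _
      refine hkc.aestronglyMeasurable.smul (Measurable.aestronglyMeasurable ?_)
      exact (measurable_fderiv ℂ f).comp
        (by fun_prop : Continuous fun θ => p + circleMap 0 R θ • e).measurable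
    · refine Filter.Eventually.of_forall fun θ _ x hx => ?_
      rw [norm_smul]
      gcongr
      exact hbound _ (hmem x hx _ (hcirc θ))
    · exact (hkc.norm.mul continuous_const).intervalIntegrable _ _
    · refine Filter.Eventually.of_forall fun θ _ x hx => ?_
      have h := (hdiff _ (hmem x hx _ (hcirc θ))).hasFDerivAt
      exact (h.comp x ((hasFDerivAt_id x).add_const (circleMap 0 R θ • e))).const_mul (k θ)
  refine (hint.differentiableAt.const_mul (2 * Real.pi * Complex.I : ℂ)⁻¹).congr_of_eventuallyEq ?_
  filter_upwards [hp4] with x hx using hcauchy x hx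

theorem Lop_eq_fderiv {f : ℂ × ℂ × ℂ → ℂ} {p : ℂ × ℂ × ℂ} (hf : DifferentiableAt ℂ f p) :
    Lop f p = fderiv ℂ f p (1, 0, 0) + (2 / p.2.2 - 6) * fderiv ℂ f p (0, 1, 0)
      + 12 / p.2.1 * (p.2.2 - 1/4) * fderiv ℂ f p (0, 0, 1) := by
  have h : HasFDerivAt f (fderiv ℂ f p) (p.1, p.2.1, p.2.2) := hf.hasFDerivAt
  have h1 := h.comp_hasDerivAt p.1 ((hasDerivAt_id p.1).prodMk (hasDerivAt_const p.1 (p.2.1, p.2.2)))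
  have h2 := h.comp_hasDerivAt p.2.1 ((hasDerivAt_const p.2.1 p.1).prodMk
    ((hasDerivAt_id p.2.1).prodMk (hasDerivAt_const p.2.1 p.2.2)))
  have h3 := h.comp_hasDerivAt p.2.2 ((hasDerivAt_const p.2.2 p.1).prodMk
    ((hasDerivAt_const p.2.2 p.2.1).prodMk (hasDerivAt_id p.2.2)))
  exact congrArg₂ (· + ·) (congrArg₂ (· + ·) h1.deriv (congrArg _ h2.deriv))
    (congrArg _ h3.deriv)

theorem differentiableOn_Lop {Ω : Set (ℂ × ℂ × ℂ)} (hΩ : IsOpen Ω)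
    (hne : ∀ p ∈ Ω, p.2.1 ≠ 0 ∧ p.2.2 ≠ 0) {f : ℂ × ℂ × ℂ → ℂ} (hf : DifferentiableOn ℂ f Ω) :
    DifferentiableOn ℂ (Lop f) Ω := by
  refine DifferentiableOn.congr ?_ fun p hp =>
    Lop_eq_fderiv (hf.differentiableAt (hΩ.mem_nhds hp))
  have hv : DifferentiableOn ℂ (fun p : ℂ × ℂ × ℂ => p.2.1) Ω := by fun_prop
  have hw : DifferentiableOn ℂ (fun p : ℂ × ℂ × ℂ => p.2.2) Ω := by fun_prop
  have hd := differentiableOn_fderiv_apply_const hf hΩ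
  simp only [div_eq_mul_inv]
  exact ((hd _).add ((((hw.fun_inv fun p hp => (hne p hp).2).const_mul 2).sub_const 6).mul
    (hd _))).add ((((hv.fun_inv fun p hp => (hne p hp).1).const_mul 12).mul
      (hw.sub_const _)).mul (hd _))

/-- `Lop f` is the derivative of `f` along the solutions of the system `v' = 2/w − 6`,
`w' = (12/v)(w − 1/4)`. -/
theorem hasDerivAt_comp_trajectory {f : ℂ × ℂ × ℂ → ℂ} {v w : ℂ → ℂ} {t : ℂ}
    (hf : DifferentiableAt ℂ f (t, v t, w t)) (hv : HasDerivAt v (2 / w t - 6) t)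
    (hw : HasDerivAt w (12 / v t * (w t - 1/4)) t) :
    HasDerivAt (fun t => f (t, v t, w t)) (Lop f (t, v t, w t)) t := by
  have h := hf.hasFDerivAt.comp_hasDerivAt t ((hasDerivAt_id t).prodMk (hv.prodMk hw))
  refine h.congr_deriv ?_
  rw [Lop_eq_fderiv hf]
  have : ((1, 2 / w t - 6, 12 / v t * (w t - 1/4)) : ℂ × ℂ × ℂ) = (1, 0, 0)
      + (2 / w t - 6) • (0, 1, 0) + (12 / v t * (w t - 1/4)) • (0, 0, 1) := by simp
  rw [this, map_add, map_add, map_smul, map_smul, smul_eq_mul, smul_eq_mul]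

/-- **Step 1 of the proof of Proposition 1.** If `γ` solves the PDE
(3.14) `v (L²γ) + 6 (Lγ) − (6 + w²v⁴γ)(Lγ)³ = 0`, and `(v(t), w(t))` solves system (2.6)
with trajectory in the domain of `γ`, then — with `η = v/(Lγ)`, `θ = v²w/η²`, and
`φ(t) = γ(t, v(t), w(t))` injective with nonvanishing derivative — the transformed
functions `v₁ = η ∘ φ⁻¹`, `w₁ = θ ∘ φ⁻¹` solve system (2.5). -/
theorem system26_transforms_to_system25
    (Ω : Set (ℂ × ℂ × ℂ)) (hΩ : IsOpen Ω)
    (hne : ∀ p ∈ Ω, p.2.1 ≠ 0 ∧ p.2.2 ≠ 0)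
    (γ : ℂ × ℂ × ℂ → ℂ) (hγ : DifferentiableOn ℂ γ Ω)
    (hpde : ∀ p ∈ Ω,
      p.2.1 * Lop (Lop γ) p + 6 * Lop γ p
        - (6 + p.2.2 ^ 2 * p.2.1 ^ 4 * γ p) * (Lop γ p) ^ 3 = 0)
    (v w : ℂ → ℂ) (t₁ : ℂ) (r : ℝ) (hr : 0 < r)
    (hv : DifferentiableOn ℂ v (ball t₁ r)) (hw : DifferentiableOn ℂ w (ball t₁ r))
    (hsys : ∀ t ∈ ball t₁ r,
      deriv v t = 2 / w t - 6 ∧ deriv w t = 12 / v t * (w t - 1/4))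
    (htraj : ∀ t ∈ ball t₁ r, (t, v t, w t) ∈ Ω ∧ Lop γ (t, v t, w t) ≠ 0)
    (hinj : Set.InjOn (fun t => γ (t, v t, w t)) (ball t₁ r))
    (hd : ∀ t ∈ ball t₁ r, deriv (fun t => γ (t, v t, w t)) t ≠ 0)
    (ψ : ℂ → ℂ) (hψ : ∀ t ∈ ball t₁ r, ψ (γ (t, v t, w t)) = t) :
    ∀ x ∈ (fun t => γ (t, v t, w t)) '' (ball t₁ r),
      deriv (fun x => (fun p => p.2.1 / Lop γ p) (ψ x, v (ψ x), w (ψ x))) x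
          = 2 / ((fun p => p.2.1 ^ 2 * p.2.2 / (p.2.1 / Lop γ p) ^ 2) (ψ x, v (ψ x), w (ψ x))) - 6
            - x * ((fun p => p.2.1 ^ 2 * p.2.2 / (p.2.1 / Lop γ p) ^ 2) (ψ x, v (ψ x), w (ψ x))) ^ 2
              * ((fun p => p.2.1 / Lop γ p) (ψ x, v (ψ x), w (ψ x))) ^ 4 ∧
      deriv (fun x => (fun p => p.2.1 ^ 2 * p.2.2 / (p.2.1 / Lop γ p) ^ 2) (ψ x, v (ψ x), w (ψ x))) x
          = 12 / ((fun p => p.2.1 / Lop γ p) (ψ x, v (ψ x), w (ψ x)))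
              * ((fun p => p.2.1 ^ 2 * p.2.2 / (p.2.1 / Lop γ p) ^ 2) (ψ x, v (ψ x), w (ψ x)) - 1/4)
            + 2 * x * ((fun p => p.2.1 ^ 2 * p.2.2 / (p.2.1 / Lop γ p) ^ 2) (ψ x, v (ψ x), w (ψ x))) ^ 3
              * ((fun p => p.2.1 / Lop γ p) (ψ x, v (ψ x), w (ψ x))) ^ 3 := by
  rintro _ ⟨t, ht, rfl⟩
  have htn : ball t₁ r ∈ nhds t := isOpen_ball.mem_nhds ht
  have hv' : ∀ s ∈ ball t₁ r, HasDerivAt v (2 / w s - 6) s := fun s hs =>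
    (hsys s hs).1 ▸ (hv.differentiableAt (isOpen_ball.mem_nhds hs)).hasDerivAt
  have hw' : ∀ s ∈ ball t₁ r, HasDerivAt w (12 / v s * (w s - 1/4)) s := fun s hs =>
    (hsys s hs).2 ▸ (hw.differentiableAt (isOpen_ball.mem_nhds hs)).hasDerivAt
  have hφ : ∀ s ∈ ball t₁ r,
      HasDerivAt (fun t => γ (t, v t, w t)) (Lop γ (s, v s, w s)) s := fun s hs =>
    hasDerivAt_comp_trajectory (hγ.differentiableAt (hΩ.mem_nhds (htraj s hs).1))
      (hv' s hs) (hw' s hs)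
  have hΩt := hΩ.mem_nhds (htraj t ht).1
  have hℓ : HasDerivAt (fun t => Lop γ (t, v t, w t)) (Lop (Lop γ) (t, v t, w t)) t :=
    hasDerivAt_comp_trajectory ((differentiableOn_Lop hΩ hne hγ).differentiableAt hΩt) (hv' t ht) (hw' t ht)
  have hφs : HasStrictDerivAt (fun t => γ (t, v t, w t)) (Lop γ (t, v t, w t)) t := by
    have hd : DifferentiableOn ℂ (fun t => γ (t, v t, w t)) (ball t₁ r) := fun s hs =>
      (hφ s hs).differentiableAt.differentiableWithinAt
    simpa only [(hφ t ht).deriv] using (hd.analyticAt htn).hasStrictDerivAt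
  have hℓ0 := (htraj t ht).2
  have hψ' : HasDerivAt ψ (Lop γ (t, v t, w t))⁻¹ (γ (t, v t, w t)) :=
    (hφs.to_local_left_inverse hℓ0 (Filter.eventually_of_mem htn hψ)).hasDerivAt
  have hψt := hψ t ht
  obtain ⟨hv0, hw0⟩ := hne _ (htraj t ht).1
  have hpde' := hpde _ (htraj t ht).1
  dsimp only at hv0 hw0 hpde' ⊢
  have hη := (hv' t ht).div hℓ hℓ0
  have hθ := (((hv' t ht).pow 2).mul (hw' t ht)).div (hη.pow 2)
    (pow_ne_zero 2 (div_ne_zero hv0 hℓ0))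
  have hη' := HasDerivAt.comp_of_eq _ hη hψ' hψt.symm
  have hθ' := HasDerivAt.comp_of_eq _ hθ hψ' hψt.symm
  have hpde'' : Lop (Lop γ) (t, v t, w t) = ((6 + w t ^ 2 * v t ^ 4 * γ (t, v t, w t))
      * Lop γ (t, v t, w t) ^ 3 - 6 * Lop γ (t, v t, w t)) / v t := by
    rw [eq_div_iff hv0]
    linear_combination hpde'
  refine ⟨hη'.deriv.trans ?_, hθ'.deriv.trans ?_⟩ <;>
    simp only [hψt, hpde'', Pi.pow_apply, Pi.mul_apply, Pi.div_apply] <;>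
    generalize Lop γ (t, v t, w t) = l at hℓ0 ⊢ <;>
    generalize γ (t, v t, w t) = x <;>
    push_cast <;>
    field_simp <;>
    ring
end

section
/- There exists a constant C > 0 such that for every integer k ≥ 7, setting α₁ = 1 − k/6 and α₂ = −1/6 − k/6, one has ∫₀¹ |α₁·s^(−1−α₁) − α₂·s^(−1−α₂)| ds ≤ C/k. (Here −1−α₁ = k/6 − 2 > −1 and −1−α₂ = k/6 − 5/6 > −1, so the integral converges.) -/
/-- For `0 < b ≤ c`, the function `c s^(c-1) - b s^(b-1)` has `L¹` norm on `[0, 1]` at most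
`2 (c - b) / b`. -/
theorem integral_abs_sub_rpow_le {b c : ℝ} (hb : 0 < b) (hbc : b ≤ c) :
    (∫ s in (0:ℝ)..1, |c * s ^ (c - 1) - b * s ^ (b - 1)|) ≤ 2 * (c - b) / b := by
  have hc : 0 < c := hb.trans_le hbc
  have ib : IntervalIntegrable (fun s : ℝ => s ^ (b - 1)) MeasureTheory.volume 0 1 :=
    intervalIntegral.intervalIntegrable_rpow' (by linarith)
  have ic : IntervalIntegrable (fun s : ℝ => s ^ (c - 1)) MeasureTheory.volume 0 1 :=
    intervalIntegral.intervalIntegrable_rpow' (by linarith)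
  have integral_unit {a : ℝ} (ha : 0 < a) : (∫ s in (0:ℝ)..1, s ^ (a - 1)) = 1 / a := by
    rw [integral_rpow (Or.inl (by linarith))]
    simp [Real.zero_rpow ha.ne']
  calc (∫ s in (0:ℝ)..1, |c * s ^ (c - 1) - b * s ^ (b - 1)|)
      ≤ ∫ s in (0:ℝ)..1, ((2 * c - b) * s ^ (b - 1) - c * s ^ (c - 1)) := by
        refine intervalIntegral.integral_mono_on_of_le_Ioo zero_le_one
          ((ic.const_mul c).sub (ib.const_mul b)).abs
          ((ib.const_mul (2 * c - b)).sub (ic.const_mul c)) fun s hs => ?_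
        have hle : s ^ (c - 1) ≤ s ^ (b - 1) :=
          Real.rpow_le_rpow_of_exponent_ge hs.1 hs.2.le (by linarith)
        have hpos : 0 ≤ s ^ (b - 1) := Real.rpow_nonneg hs.1.le _
        rw [abs_le]
        constructor <;>
          nlinarith [mul_nonneg hc.le (sub_nonneg.2 hle), mul_nonneg (sub_nonneg.2 hbc) hpos]
    _ = 2 * (c - b) / b := by
        rw [intervalIntegral.integral_sub (ib.const_mul _) (ic.const_mul _),
          intervalIntegral.integral_const_mul, intervalIntegral.integral_const_mul,
          integral_unit hb, integral_unit hc]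
        field_simp
        ring

/-- **estimate (3.49).** There is a constant `C > 0` such that for all
integers `k ≥ 7`, with `α₁ = 1 − k/6`, `α₂ = −1/6 − k/6`,
`∫₀¹ |α₁ s^(−1−α₁) − α₂ s^(−1−α₂)| ds ≤ C/k`. -/
theorem indicial_integral_estimate :
    ∃ C : ℝ, 0 < C ∧
      ∀ k : ℕ, 7 ≤ k →
        (∫ s in (0:ℝ)..1,
          |(1 - (k : ℝ) / 6) * s ^ (-1 - (1 - (k : ℝ) / 6))
            - (-1/6 - (k : ℝ) / 6) * s ^ (-1 - (-1/6 - (k : ℝ) / 6))|)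
          ≤ C / k := by
  refine ⟨98, by norm_num, fun k hk => ?_⟩
  have hk' : (7 : ℝ) ≤ k := by exact_mod_cast hk
  have h := integral_abs_sub_rpow_le (b := (k : ℝ) / 6 - 1) (c := (k : ℝ) / 6 + 1 / 6)
    (by linarith) (by linarith)
  have hbound : 2 * (((k : ℝ) / 6 + 1 / 6) - ((k : ℝ) / 6 - 1)) / ((k : ℝ) / 6 - 1) ≤ 98 / k := by
    rw [div_le_div_iff₀ (by linarith) (by linarith)]
    linarith
  refine le_trans (le_of_eq ?_) (h.trans hbound)
  congr 1 with s
  congr 1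
  rw [show -1 - (1 - (k : ℝ) / 6) = (k : ℝ) / 6 - 1 - 1 by ring,
    show -1 - (-1/6 - (k : ℝ) / 6) = (k : ℝ) / 6 + 1 / 6 - 1 by ring]
  ring
end
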